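/- Let R be either L or H and let S ⊆ R (possibly infinite) be such that for every integer n ≥ 2 and every α ∈ S there exists β ∈ S satisfying: (i) the minimal polynomials of α and β are congruent coefficientwise modulo n (i.e., every coefficient of μ_α − μ_β is divisible by n), and (ii) α − β ≡ (i−j) (mod nR) or α − β ≡ −(i−j) (mod nR). Then S is a ringset of R. -/

import Mathlib

noncomputable section

open Polynomial

abbrev 𝔻 : Type := Quaternion ℚ

def qi : 𝔻 := QuaternionAlgebra.mk 0 1 0 0
def qj : 𝔻 := QuaternionAlgebra.mk 0 0 1 0
def qk : 𝔻 := QuaternionAlgebra.mk 0 0 0 1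

def isIntQ (q : ℚ) : Prop := ∃ z : ℤ, q = (z : ℚ)
def isHalfOddQ (q : ℚ) : Prop := ∃ z : ℤ, q = (z : ℚ) + 1/2

def Lip : Set 𝔻 :=
  {α | isIntQ α.re ∧ isIntQ α.imI ∧ isIntQ α.imJ ∧ isIntQ α.imK}

def HurOff : Set 𝔻 :=
  {α | isHalfOddQ α.re ∧ isHalfOddQ α.imI ∧ isHalfOddQ α.imJ ∧ isHalfOddQ α.imK}

def Hur : Set 𝔻 := Lip ∪ HurOff

def qnorm (α : 𝔻) : ℚ := α.re ^ 2 + α.imI ^ 2 + α.imJ ^ 2 + α.imK ^ 2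

def minPoly (α : 𝔻) : Polynomial ℚ :=
  if α.imI = 0 ∧ α.imJ = 0 ∧ α.imK = 0 then X - C α.re
  else X ^ 2 - C (2 * α.re) * X + C (qnorm α)

def classOf (R : Set 𝔻) (m : Polynomial ℤ) : Set 𝔻 :=
  {α | α ∈ R ∧ minPoly α = m.map (Int.castRingHom ℚ)}

def IntPolys (S R : Set 𝔻) : Set (Polynomial 𝔻) :=
  {f | ∀ α ∈ S, f.eval α ∈ R}

def IsRingset (S R : Set 𝔻) : Prop :=
  ∀ f ∈ IntPolys S R, ∀ g ∈ IntPolys S R, f * g ∈ IntPolys S R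

def transSet (S : Set 𝔻) (a : ℤ) : Set 𝔻 := (fun α => α + (a : 𝔻)) '' S

def scaleSet (n : ℤ) (R : Set 𝔻) : Set 𝔻 := (fun α => (n : 𝔻) * α) '' R

def IsReducedIn (S R : Set 𝔻) : Prop :=
  (∃ m : Polynomial ℤ, m.Monic ∧ m.natDegree = 2 ∧ S ⊆ classOf R m) ∧
  (∀ a n : ℤ, 2 ≤ n → ¬ (transSet S a ⊆ scaleSet n R))

def diffs (S : Set 𝔻) : Set 𝔻 := {δ | ∃ α ∈ S, ∃ β ∈ S, δ = α - β}

def normsOf (S : Set 𝔻) : Set ℤ := {n : ℤ | ∃ δ ∈ diffs S, (n : ℚ) = qnorm δ}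

def gam (S : Set 𝔻) : ℕ := sSup {g : ℕ | ∀ t ∈ normsOf S, (g : ℤ) ∣ t}

def starSet (S R : Set 𝔻) : Set 𝔻 :=
  {β | ∃ α ∈ S, ∃ u v : 𝔻, u ∈ R ∧ v ∈ R ∧ u * v = 1 ∧ v * u = 1 ∧ β = u * α * v}

def idealGen (R : Set 𝔻) (x : 𝔻) : Set 𝔻 :=
  {β | ∃ n : ℕ, ∃ a b : Fin n → 𝔻, (∀ k, a k ∈ R) ∧ (∀ k, b k ∈ R) ∧ β = ∑ k, a k * x * b k}

open scoped Quaternion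

/-- The quaternion with the given coordinates, typed as an element of `𝔻`. -/
def quatMk (w x y z : ℚ) : 𝔻 := QuaternionAlgebra.mk w x y z

@[simp] theorem re_quatMk (w x y z : ℚ) : (quatMk w x y z).re = w := rfl

@[simp] theorem imI_quatMk (w x y z : ℚ) : (quatMk w x y z).imI = x := rfl

@[simp] theorem imJ_quatMk (w x y z : ℚ) : (quatMk w x y z).imJ = y := rfl

@[simp] theorem imK_quatMk (w x y z : ℚ) : (quatMk w x y z).imK = z := rfl

theorem qi_eq : qi = quatMk 0 1 0 0 := rfl

theorem qj_eq : qj = quatMk 0 0 1 0 := rfl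

theorem mem_Hur_iff {α : 𝔻} : α ∈ Hur ↔ ∃ a b c d : ℤ,
    α = quatMk (d / 2) (a + d / 2) (b + d / 2) (c + d / 2) := by
  constructor
  · rintro (⟨⟨w, hw⟩, ⟨x, hx⟩, ⟨y, hy⟩, ⟨z, hz⟩⟩ | ⟨⟨w, hw⟩, ⟨x, hx⟩, ⟨y, hy⟩, ⟨z, hz⟩⟩)
    · refine ⟨x - w, y - w, z - w, 2 * w, ?_⟩
      ext <;> simp [*]
    · refine ⟨x - w, y - w, z - w, 2 * w + 1, ?_⟩
      ext <;> simp [*] <;> ring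
  · rintro ⟨a, b, c, d, rfl⟩
    rcases Int.even_or_odd' d with ⟨e, rfl | rfl⟩
    · left
      refine ⟨⟨e, ?_⟩, ⟨a + e, ?_⟩, ⟨b + e, ?_⟩, ⟨c + e, ?_⟩⟩ <;>
        simp only [re_quatMk, imI_quatMk, imJ_quatMk, imK_quatMk] <;> push_cast <;> ring
    · right
      refine ⟨⟨e, ?_⟩, ⟨a + e, ?_⟩, ⟨b + e, ?_⟩, ⟨c + e, ?_⟩⟩ <;>
        simp only [re_quatMk, imI_quatMk, imJ_quatMk, imK_quatMk] <;> push_cast <;> ring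

theorem mem_Lip_iff {α : 𝔻} : α ∈ Lip ↔ ∃ a b c d : ℤ,
    α = quatMk d a b c := by
  constructor
  · rintro ⟨⟨w, hw⟩, ⟨x, hx⟩, ⟨y, hy⟩, ⟨z, hz⟩⟩
    exact ⟨x, y, z, w, by ext <;> simp [*]⟩
  · rintro ⟨a, b, c, d, rfl⟩
    exact ⟨⟨d, rfl⟩, ⟨a, rfl⟩, ⟨b, rfl⟩, ⟨c, rfl⟩⟩

/-- The Lipschitz quaternions as a subring. -/
def lipschitzSubring : Subring 𝔻 where
  carrier := Lip
  zero_mem' := mem_Lip_iff.2 ⟨0, 0, 0, 0, by ext <;> simp⟩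
  one_mem' := mem_Lip_iff.2 ⟨0, 0, 0, 1, by ext <;> simp⟩
  add_mem' := by
    simp only [mem_Lip_iff]
    rintro _ _ ⟨a, b, c, d, rfl⟩ ⟨a', b', c', d', rfl⟩
    exact ⟨a + a', b + b', c + c', d + d', by ext <;> simp⟩
  neg_mem' := by
    simp only [mem_Lip_iff]
    rintro _ ⟨a, b, c, d, rfl⟩
    exact ⟨-a, -b, -c, -d, by ext <;> simp⟩
  mul_mem' := by
    simp only [mem_Lip_iff]
    rintro _ _ ⟨a, b, c, d, rfl⟩ ⟨a', b', c', d', rfl⟩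
    exact ⟨d * a' + a * d' + b * c' - c * b', d * b' - a * c' + b * d' + c * a',
      d * c' + a * b' - b * a' + c * d', d * d' - a * a' - b * b' - c * c', by ext <;> simp⟩

/-- The Hurwitz quaternions as a subring. -/
def hurwitzSubring : Subring 𝔻 where
  carrier := Hur
  zero_mem' := mem_Hur_iff.2 ⟨0, 0, 0, 0, by ext <;> simp⟩
  one_mem' := mem_Hur_iff.2 ⟨-1, -1, -1, 2, by ext <;> simp⟩
  add_mem' := by
    simp only [mem_Hur_iff]
    rintro _ _ ⟨a, b, c, d, rfl⟩ ⟨a', b', c', d', rfl⟩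
    exact ⟨a + a', b + b', c + c', d + d', by ext <;> simp <;> ring⟩
  neg_mem' := by
    simp only [mem_Hur_iff]
    rintro _ ⟨a, b, c, d, rfl⟩
    exact ⟨-a, -b, -c, -d, by ext <;> simp <;> ring⟩
  mul_mem' := by
    simp only [mem_Hur_iff]
    rintro _ _ ⟨a, b, c, d, rfl⟩ ⟨a', b', c', d', rfl⟩
    exact ⟨d * d' + (a * a' + b * b' + c * c') + d * (a' + c') + (a + b) * d' + b * c' - c * b',
      d * d' + (a * a' + b * b' + c * c') + d * (b' + a') + (b + c) * d' + c * a' - a * c',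
      d * d' + (a * a' + b * b' + c * c') + d * (c' + b') + (c + a) * d' + a * b' - b * a',
      -(d * d') - 2 * (a * a' + b * b' + c * c') - (a + b + c) * d' - d * (a' + b' + c'),
      by ext <;> simp <;> ring⟩

/-- The properties shared by the Lipschitz and the Hurwitz order on which the ringset criterion
depends. -/
structure IsQuaternionOrder (A : Subring 𝔻) : Prop where
  lip_le : ∀ α ∈ Lip, α ∈ A
  trace_int : ∀ α ∈ A, isIntQ (2 * α.re)
  norm_int : ∀ α ∈ A, isIntQ (qnorm α)
  two_imI_int : ∀ α ∈ A, isIntQ (2 * α.imI)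
  commutator : ∀ γ ∈ A, ∀ α ∈ A, ∃ e ∈ A, γ * α - α * γ = (qi - qj) * e

theorem isQuaternionOrder_lipschitzSubring : IsQuaternionOrder lipschitzSubring where
  lip_le _ h := h
  trace_int := by
    intro α h
    obtain ⟨a, b, c, d, rfl⟩ := mem_Lip_iff.1 h
    exact ⟨2 * d, by simp⟩
  norm_int := by
    intro α h
    obtain ⟨a, b, c, d, rfl⟩ := mem_Lip_iff.1 h
    exact ⟨d ^ 2 + a ^ 2 + b ^ 2 + c ^ 2, by simp [qnorm]⟩
  two_imI_int := by
    intro α h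
    obtain ⟨a, b, c, d, rfl⟩ := mem_Lip_iff.1 h
    exact ⟨2 * a, by simp⟩
  commutator := by
    intro γ hγ α hα
    obtain ⟨a, b, c, d, rfl⟩ := mem_Lip_iff.1 hγ
    obtain ⟨a', b', c', d', rfl⟩ := mem_Lip_iff.1 hα
    let x := b * c' - c * b'
    let y := c * a' - a * c'
    let z := a * b' - b * a'
    refine ⟨_, mem_Lip_iff.2 ⟨z, z, -(x + y), x - y, rfl⟩, ?_⟩
    ext <;> simp [qi_eq, qj_eq, x, y, z] <;> ring

theorem isQuaternionOrder_hurwitzSubring : IsQuaternionOrder hurwitzSubring where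
  lip_le _ h := Or.inl h
  trace_int := by
    intro α h
    obtain ⟨a, b, c, d, rfl⟩ := mem_Hur_iff.1 h
    exact ⟨d, by simp; ring⟩
  norm_int := by
    intro α h
    obtain ⟨a, b, c, d, rfl⟩ := mem_Hur_iff.1 h
    exact ⟨d ^ 2 + a ^ 2 + b ^ 2 + c ^ 2 + (a + b + c) * d, by simp [qnorm]; ring⟩
  two_imI_int := by
    intro α h
    obtain ⟨a, b, c, d, rfl⟩ := mem_Hur_iff.1 h
    exact ⟨2 * a + d, by simp; ring⟩
  commutator := by
    intro γ hγ α hα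
    obtain ⟨a, b, c, d, rfl⟩ := mem_Hur_iff.1 hγ
    obtain ⟨a', b', c', d', rfl⟩ := mem_Hur_iff.1 hα
    let x := 2 * (b * c' - c * b') + (b - c) * d' + d * (c' - b')
    let y := 2 * (c * a' - a * c') + (c - a) * d' + d * (a' - c')
    let t := a * b' - b * a' - (b * c' - c * b') + (c * a' - a * c') + d' * (c - b) + d * (b' - c')
    refine ⟨_, mem_Hur_iff.2 ⟨t, t, -x, x - y, rfl⟩, ?_⟩
    ext <;> simp [qi_eq, qj_eq, x, y, t] <;> ring

/-- The coefficients `(c, d)` for which `X ^ m ≡ c * X + d` modulo `X ^ 2 - t * X + s`. -/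
def quadraticPowRem (t s : ℤ) : ℕ → ℤ × ℤ
  | 0 => (0, 1)
  | m + 1 => (t * (quadraticPowRem t s m).1 + (quadraticPowRem t s m).2,
      -(s * (quadraticPowRem t s m).1))

theorem pow_eq_quadraticPowRem {A : Type*} [Ring A] {t s : ℤ} {x : A}
    (hx : x ^ 2 = t * x - s) (m : ℕ) :
    x ^ m = (quadraticPowRem t s m).1 * x + (quadraticPowRem t s m).2 := by
  induction m with
  | zero => simp [quadraticPowRem]
  | succ m ih =>
    rw [pow_succ, ih, add_mul, mul_assoc, ← sq, hx]
    simp only [quadraticPowRem, Int.cast_add, Int.cast_mul, Int.cast_neg]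
    rw [(Int.cast_commute t ((quadraticPowRem t s m).1 : A)).eq,
      (Int.cast_commute s ((quadraticPowRem t s m).1 : A)).eq]
    noncomm_ring

theorem quadraticPowRem_modEq {n t s t' s' : ℤ} (ht : t ≡ t' [ZMOD n]) (hs : s ≡ s' [ZMOD n])
    (m : ℕ) : (quadraticPowRem t s m).1 ≡ (quadraticPowRem t' s' m).1 [ZMOD n] ∧
      (quadraticPowRem t s m).2 ≡ (quadraticPowRem t' s' m).2 [ZMOD n] := by
  induction m with
  | zero => exact ⟨rfl, rfl⟩
  | succ m ih => exact ⟨(ht.mul ih.1).add ih.2, (hs.mul ih.1).neg⟩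

theorem sq_eq_trace_mul_sub_norm {α : 𝔻} {t s : ℤ} (ht : 2 * α.re = t) (hs : qnorm α = s) :
    α ^ 2 = t * α - s := by
  have h₁ : (t : 𝔻) = ((t : ℚ) : 𝔻) := by simp
  have h₂ : (s : 𝔻) = ((s : ℚ) : 𝔻) := by simp
  rw [h₁, h₂, ← ht, ← hs, sq]
  ext <;> simp [qnorm] <;> ring

theorem eval_mul_eq_sum {A : Type*} [Semiring A] (f g : A[X]) (x : A) :
    (f * g).eval x = ∑ m ∈ f.support, f.coeff m * g.eval x * x ^ m := by
  conv_lhs => rw [f.as_sum_support]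
  rw [Finset.sum_mul, eval_finsetSum]
  refine Finset.sum_congr rfl fun m _ => ?_
  rw [← C_mul_X_pow_eq_monomial, mul_assoc, X_pow_mul, eval_C_mul, eval_mul_X_pow, mul_assoc]

theorem exists_pos_int_mul_mem_Lip (q : 𝔻) : ∃ n : ℤ, 0 < n ∧ (n : 𝔻) * q ∈ Lip := by
  have key : ∀ (r : ℚ) (z : ℤ), isIntQ ((r.den * z : ℤ) * r) := fun r z =>
    ⟨r.num * z, by
      push_cast
      rw [mul_right_comm, Rat.den_mul_eq_num]⟩
  refine ⟨q.re.den * q.imI.den * q.imJ.den * q.imK.den, by positivity, ?_⟩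
  refine ⟨?_, ?_, ?_, ?_⟩
  · convert key q.re (q.imI.den * q.imJ.den * q.imK.den) using 1
    simp
    exact .inl (by ring)
  · convert key q.imI (q.re.den * q.imJ.den * q.imK.den) using 1
    simp
    exact .inl (by ring)
  · convert key q.imJ (q.re.den * q.imI.den * q.imK.den) using 1
    simp
    exact .inl (by ring)
  · convert key q.imK (q.re.den * q.imI.den * q.imJ.den) using 1
    simp
    exact .inl (by ring)

theorem exists_pos_int_mul_coeff_mem_Lip (f : 𝔻[X]) :
    ∃ n : ℤ, 0 < n ∧ ∀ m ∈ f.support, (n : 𝔻) * f.coeff m ∈ Lip := by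
  choose d hd hmem using fun m => exists_pos_int_mul_mem_Lip (f.coeff m)
  refine ⟨∏ m ∈ f.support, d m, Finset.prod_pos fun m _ => hd m, fun m hm => ?_⟩
  rw [← Finset.prod_erase_mul _ _ hm, Int.cast_mul, mul_assoc]
  exact lipschitzSubring.mul_mem (intCast_mem lipschitzSubring _) (hmem m)

theorem minPoly_congr_trace_norm {n : ℤ} (hn : 3 ≤ n) {A : Subring 𝔻}
    (hA : IsQuaternionOrder A) {α β ρ : 𝔻} (hρ : ρ ∈ A)
    (hdiff : α - β - (qi - qj) = n * ρ ∨ α - β + (qi - qj) = n * ρ)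
    (hμ : ∀ k : ℕ, ∃ c : ℤ, (minPoly α).coeff k - (minPoly β).coeff k = (n : ℚ) * c) :
    (∃ c : ℤ, 2 * α.re - 2 * β.re = (n : ℚ) * c) ∧
      ∃ c : ℤ, qnorm α - qnorm β = (n : ℚ) * c := by
  have not_dvd : ∀ {z c : ℤ}, 0 < z → z ≤ 2 → (z : ℚ) = n * c → False := by
    intro z c h₀ h₂ hz
    have : z = n * c := by exact_mod_cast hz
    have := Int.le_of_dvd h₀ ⟨c, this⟩
    omega
  have lin : ∀ a b : ℚ, (X ^ 2 - C a * X + C b : ℚ[X]).coeff 2 = 1 ∧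
      (X ^ 2 - C a * X + C b : ℚ[X]).coeff 1 = -a ∧
      (X ^ 2 - C a * X + C b : ℚ[X]).coeff 0 = b := fun a b => by
    refine ⟨?_, ?_, ?_⟩ <;> simp [coeff_X, coeff_C, coeff_X_pow]
  have lin' : ∀ a : ℚ, (X - C a : ℚ[X]).coeff 2 = 0 := fun a => by simp [coeff_X]
  obtain ⟨c₀, h₀⟩ := hμ 0
  obtain ⟨c₁, h₁⟩ := hμ 1
  obtain ⟨c₂, h₂⟩ := hμ 2
  by_cases hα : α.imI = 0 ∧ α.imJ = 0 ∧ α.imK = 0 <;>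
    by_cases hβ : β.imI = 0 ∧ β.imJ = 0 ∧ β.imK = 0
  · obtain ⟨z, hz⟩ := hA.two_imI_int ρ hρ
    exfalso
    rcases hdiff with hd | hd
    · have := congrArg QuaternionAlgebra.imI hd
      simp [qi_eq, qj_eq, hα.1, hβ.1] at this
      refine not_dvd (z := 2) (c := -z) (by norm_num) le_rfl ?_
      push_cast
      rw [← hz]
      linarith
    · have := congrArg QuaternionAlgebra.imI hd
      simp [qi_eq, qj_eq, hα.1, hβ.1] at this
      refine not_dvd (z := 2) (c := z) (by norm_num) le_rfl ?_
      rw [← hz]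
      push_cast
      linarith
  · rw [minPoly, minPoly, if_pos hα, if_neg hβ, lin', (lin _ _).1] at h₂
    exact (not_dvd (z := 1) (c := -c₂) (by norm_num) (by norm_num)
      (by push_cast; linarith)).elim
  · rw [minPoly, minPoly, if_neg hα, if_pos hβ, lin', (lin _ _).1] at h₂
    exact (not_dvd (z := 1) (c := c₂) (by norm_num) (by norm_num)
      (by push_cast; linarith)).elim
  · rw [minPoly, minPoly, if_neg hα, if_neg hβ] at h₀ h₁
    rw [(lin _ _).2.2, (lin _ _).2.2] at h₀
    rw [(lin _ _).2.1, (lin _ _).2.1] at h₁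
    exact ⟨⟨-c₁, by push_cast; linarith⟩, ⟨c₀, h₀⟩⟩

/-- If `f` takes values in `A` at both `α` and `β`, where `α` and `β` satisfy quadratic equations
congruent modulo a common denominator of `f`, then the leading coefficient of the remainder of `f`
modulo the quadratic of `α` maps `α - β` into `A`. -/
theorem sum_quadraticPowRem_mul_sub_mem {A : Subring 𝔻} {f : 𝔻[X]} {n t s t' s' : ℤ} {α β : 𝔻}
    (hf : ∀ m ∈ f.support, (n : 𝔻) * f.coeff m ∈ A) (hβ : β ∈ A)
    (hfα : f.eval α ∈ A) (hfβ : f.eval β ∈ A)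
    (hα : α ^ 2 = t * α - s) (hβ' : β ^ 2 = t' * β - s')
    (ht : t ≡ t' [ZMOD n]) (hs : s ≡ s' [ZMOD n]) :
    (∑ m ∈ f.support, f.coeff m * (quadraticPowRem t s m).1) * (α - β) ∈ A := by
  have hrest : ∑ m ∈ f.support, f.coeff m *
      ((((quadraticPowRem t s m).1 - (quadraticPowRem t' s' m).1 : ℤ) : 𝔻) * β +
        (((quadraticPowRem t s m).2 - (quadraticPowRem t' s' m).2 : ℤ) : 𝔻)) ∈ A := by
    refine A.sum_mem fun m hm => ?_
    obtain ⟨u, hu⟩ := ((quadraticPowRem_modEq ht hs m).1.symm).dvd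
    obtain ⟨v, hv⟩ := ((quadraticPowRem_modEq ht hs m).2.symm).dvd
    have : f.coeff m * (((n * u : ℤ) : 𝔻) * β + ((n * v : ℤ) : 𝔻)) =
        (n : 𝔻) * f.coeff m * (u * β + v) := by
      rw [(Int.cast_commute n (f.coeff m)).eq]
      push_cast
      noncomm_ring
    rw [hu, hv, this]
    exact A.mul_mem (hf m hm) (A.add_mem (A.mul_mem (intCast_mem A u) hβ) (intCast_mem A v))
  convert A.sub_mem (A.sub_mem hfα hfβ) hrest using 1
  rw [eval_eq_sum, eval_eq_sum, Polynomial.sum, Polynomial.sum, Finset.sum_mul,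
    ← Finset.sum_sub_distrib, ← Finset.sum_sub_distrib]
  refine Finset.sum_congr rfl fun m _ => ?_
  rw [pow_eq_quadraticPowRem hα, pow_eq_quadraticPowRem hβ']
  push_cast
  noncomm_ring

theorem eval_mul_eq_commutator_add (f g : 𝔻[X]) {t s : ℤ} {α : 𝔻} (hα : α ^ 2 = t * α - s) :
    (f * g).eval α = (∑ m ∈ f.support, f.coeff m * (quadraticPowRem t s m).1) *
      (g.eval α * α - α * g.eval α) + f.eval α * g.eval α := by
  rw [eval_mul_eq_sum, eval_eq_sum (p := f), Polynomial.sum, Finset.sum_mul, Finset.sum_mul,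
    ← Finset.sum_add_distrib]
  refine Finset.sum_congr rfl fun m _ => ?_
  rw [pow_eq_quadraticPowRem hα]
  generalize g.eval α = γ
  have h₁ := (Int.cast_commute (quadraticPowRem t s m).1 γ).eq
  have h₂ := (Int.cast_commute (quadraticPowRem t s m).2 γ).eq
  simp only [mul_add, add_mul, mul_sub, mul_assoc, h₂]
  rw [← mul_assoc γ, ← h₁]
  simp only [mul_assoc]
  abel

theorem IsQuaternionOrder.isRingset {A : Subring 𝔻} (hA : IsQuaternionOrder A) {S : Set 𝔻}
    (hsub : S ⊆ A)
    (h : ∀ n : ℤ, 2 ≤ n → ∀ α ∈ S, ∃ β ∈ S,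
      (∀ k : ℕ, ∃ c : ℤ,
        (minPoly α).coeff k - (minPoly β).coeff k = (n : ℚ) * c) ∧
      (α - β - (qi - qj) ∈ scaleSet n A ∨ α - β + (qi - qj) ∈ scaleSet n A)) :
    IsRingset S A := by
  intro f hf g hg α hα
  obtain ⟨n₀, hn₀, hlip⟩ := exists_pos_int_mul_coeff_mem_Lip f
  have hcoeff : ∀ m ∈ f.support, ((3 * n₀ : ℤ) : 𝔻) * f.coeff m ∈ A := fun m hm => by
    rw [Int.cast_mul, mul_assoc]
    exact A.mul_mem (intCast_mem A 3) (hA.lip_le _ (hlip m hm))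
  have hn : 3 ≤ 3 * n₀ := by omega
  generalize 3 * n₀ = n at hcoeff hn
  obtain ⟨β, hβ, hμ, hd⟩ := h n (by omega) α hα
  obtain ⟨ρ, hρ, hdiff⟩ : ∃ ρ ∈ A,
      α - β - (qi - qj) = n * ρ ∨ α - β + (qi - qj) = n * ρ := by
    rcases hd with ⟨ρ, hρ, e⟩ | ⟨ρ, hρ, e⟩
    · exact ⟨ρ, hρ, .inl e.symm⟩
    · exact ⟨ρ, hρ, .inr e.symm⟩
  obtain ⟨⟨u, hu⟩, v, hv⟩ := minPoly_congr_trace_norm hn hA hρ hdiff hμ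
  obtain ⟨t, ht⟩ := hA.trace_int α (hsub hα)
  obtain ⟨s, hs⟩ := hA.norm_int α (hsub hα)
  obtain ⟨t', ht'⟩ := hA.trace_int β (hsub hβ)
  obtain ⟨s', hs'⟩ := hA.norm_int β (hsub hβ)
  have htt : t ≡ t' [ZMOD n] := by
    refine (Int.modEq_of_dvd ⟨u, ?_⟩).symm
    rw [ht, ht'] at hu
    exact_mod_cast hu
  have hss : s ≡ s' [ZMOD n] := by
    refine (Int.modEq_of_dvd ⟨v, ?_⟩).symm
    rw [hs, hs'] at hv
    exact_mod_cast hv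
  have hαq := sq_eq_trace_mul_sub_norm ht hs
  have hlead := sum_quadraticPowRem_mul_sub_mem hcoeff (hsub hβ) (hf α hα) (hf β hβ) hαq
    (sq_eq_trace_mul_sub_norm ht' hs') htt hss
  have hnlead : (n : 𝔻) * ∑ m ∈ f.support, f.coeff m * (quadraticPowRem t s m).1 ∈ A := by
    rw [Finset.mul_sum]
    refine A.sum_mem fun m hm => ?_
    rw [← mul_assoc]
    exact A.mul_mem (hcoeff m hm) (intCast_mem A _)
  have heval := eval_mul_eq_commutator_add f g hαq
  generalize ∑ m ∈ f.support, f.coeff m * ((quadraticPowRem t s m).1 : 𝔻) = c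
    at hlead hnlead heval
  have hc : c * (qi - qj) ∈ A := by
    have hcn : c * (n * ρ) ∈ A := by
      rw [← mul_assoc, ← (Int.cast_commute n c).eq]
      exact A.mul_mem hnlead hρ
    rcases hdiff with hd | hd
    · convert A.sub_mem hlead hcn using 1
      rw [← hd]
      noncomm_ring
    · convert A.sub_mem hcn hlead using 1
      rw [← hd]
      noncomm_ring
  obtain ⟨e, he, hcomm⟩ := hA.commutator (g.eval α) (hg α hα) α (hsub hα)
  change (f * g).eval α ∈ A
  rw [heval, hcomm, ← mul_assoc]
  exact A.add_mem (A.mul_mem hc he) (A.mul_mem (hf α hα) (hg α hα))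

/-- A sufficient condition for (possibly infinite) subsets of R to be ringsets. -/
theorem stmt_19 (R : Set 𝔻) (hR : R = Lip ∨ R = Hur) (S : Set 𝔻) (hsub : S ⊆ R)
    (h : ∀ n : ℤ, 2 ≤ n → ∀ α ∈ S, ∃ β ∈ S,
      (∀ k : ℕ, ∃ c : ℤ,
        (minPoly α).coeff k - (minPoly β).coeff k = (n : ℚ) * c) ∧
      (α - β - (qi - qj) ∈ scaleSet n R ∨ α - β + (qi - qj) ∈ scaleSet n R)) :
    IsRingset S R := by
  rcases hR with rfl | rfl
  · exact isQuaternionOrder_lipschitzSubring.isRingset hsub h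
  · exact isQuaternionOrder_hurwitzSubring.isRingset hsub h
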